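/- Let H be a k-regular bipartite graph with both sides of size n, where k ≥ 2 is even. Then the number of 2-factors of H is at least P(k)·P(k−1)/2^n, where P(j) denotes the minimum over j-regular bipartite graphs (with sides of size n) of the number of perfect matchings, and in particular, using the van der Waerden bound P(j) ≥ n!·(j/n)^n, the number of 2-factors of H is at least n!²·(k(k−1))^n/(n^(2n)·2^n). -/

import Mathlib

def rowDeg {n : ℕ} (E : Finset (Fin n × Fin n)) (i : Fin n) : ℕ :=
  (E.filter fun p => p.1 = i).card

def colDeg {n : ℕ} (E : Finset (Fin n × Fin n)) (j : Fin n) : ℕ :=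
  (E.filter fun p => p.2 = j).card

/-- `P(j)`: the minimum, over `j`-regular bipartite graphs with both sides of size `n`,
of the number of perfect matchings. -/
noncomputable def pmMin (n j : ℕ) : ℕ :=
  sInf {c : ℕ | ∃ E : Finset (Fin n × Fin n),
    (∀ i, rowDeg E i = j) ∧ (∀ v, colDeg E v = j) ∧
    c = Set.ncard {M : Finset (Fin n × Fin n) |
      M ⊆ E ∧ (∀ i, rowDeg M i = 1) ∧ (∀ v, colDeg M v = 1)}}

open Polynomial Finset

/-- A form of the AM-GM inequality: each factor satisfies `u ≤ m * exp (u / m - 1)`. -/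
lemma Multiset.prod_map_le_pow_mul_exp {ι : Type*} (s : Multiset ι) (u : ι → ℝ)
    (hu : ∀ i ∈ s, 0 ≤ u i) {m : ℝ} (hm : 0 < m) :
    (s.map u).prod ≤ m ^ s.card * Real.exp ((s.map u).sum / m - s.card) := by
  induction s using Multiset.induction_on with
  | empty => simp
  | cons a s ih =>
    have h1 : u a ≤ m * Real.exp (u a / m - 1) := by
      have := Real.add_one_le_exp (u a / m - 1)
      calc u a = m * (u a / m - 1 + 1) := by field_simp; ring
        _ ≤ _ := by gcongr
    have h2 := ih fun i hi => hu i (Multiset.mem_cons_of_mem hi)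
    rw [Multiset.map_cons, Multiset.prod_cons, Multiset.sum_cons, Multiset.card_cons]
    have h0 : 0 ≤ (s.map u).prod := Multiset.prod_nonneg fun x hx => by
      obtain ⟨i, hi, rfl⟩ := Multiset.mem_map.1 hx
      exact hu i (Multiset.mem_cons_of_mem hi)
    calc u a * (s.map u).prod
        ≤ (m * Real.exp (u a / m - 1)) * (m ^ s.card * Real.exp ((s.map u).sum / m - s.card)) := by
          gcongr
      _ = m ^ (s.card + 1) * (Real.exp (u a / m - 1) * Real.exp ((s.map u).sum / m - s.card)) := by
          ring
      _ = _ := by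
          rw [← Real.exp_add]; congr 2; push_cast; ring

/-- A complex number off the closed negative real axis can be rotated, together with `1`, into the
open right half-plane. -/
lemma Complex.exists_re_pos_re_mul_pos {t : ℂ} (ht : t ≠ -(‖t‖ : ℂ)) :
    ∃ l : ℂ, 0 < l.re ∧ 0 < (l * t).re := by
  have hre : 0 < ‖t‖ + t.re := by
    rcases (neg_le_of_abs_le (Complex.abs_re_le_norm t)).lt_or_eq with h | h
    · linarith
    · exfalso
      apply ht
      have h2 : |t.re| = ‖t‖ := by rw [← h, abs_neg, abs_norm]
      have him := (Complex.abs_re_eq_norm).1 h2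
      apply Complex.ext <;> simp [him, h]
  refine ⟨‖t‖ + (starRingEnd ℂ) t, by simpa using hre, ?_⟩
  have : ((‖t‖ + (starRingEnd ℂ) t) * t).re = ‖t‖ * (‖t‖ + t.re) := by
    have h2 : ‖t‖ * ‖t‖ = t.re * t.re + t.im * t.im := by
      rw [Complex.norm_mul_self_eq_normSq, Complex.normSq_apply]
    simp [Complex.add_re, add_mul, mul_add]
    linarith
  rw [this]
  have : t ≠ 0 := by rintro rfl; simp at ht
  positivity

/-- Gurvits's univariate inequality: if all `k` roots of `P` are negative reals and `B * t ≤ |P(t)|`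
for `t > 0`, then `B * ((k - 1) / k) ^ (k - 1) ≤ |derivative of P at 0|`. -/
lemma Polynomial.le_norm_eval_derivative_zero {P : ℂ[X]} {k : ℕ} (hk : 2 ≤ k)
    (hdeg : P.natDegree = k) (hroots : ∀ r ∈ P.roots, r ≠ 0 ∧ r = -(‖r‖ : ℂ))
    {B : ℝ} (hB : ∀ t : ℝ, 0 < t → B * t ≤ ‖P.eval (t : ℂ)‖) :
    B * (((k : ℝ) - 1) / k) ^ (k - 1) ≤ ‖P.derivative.eval 0‖ := by
  have hP0 : P ≠ 0 := by rintro rfl; simp at hdeg; omega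
  have hsplit : P.Splits := IsAlgClosed.splits P
  have hcard : P.roots.card = k := by rw [← hdeg]; exact hsplit.natDegree_eq_card_roots.symm
  have h0 : P.eval 0 ≠ 0 := fun h => (hroots 0 ((mem_roots hP0).2 h)).1 rfl
  set b : ℂ → ℝ := fun r => ‖r‖⁻¹
  set s : ℝ := (P.roots.map b).sum with hs
  have hspos : 0 < s := by
    obtain ⟨r, hr⟩ := Multiset.card_pos_iff_exists_mem.1 (show 0 < P.roots.card by omega)
    refine (inv_pos.2 (norm_pos_iff.2 (hroots r hr).1)).trans_le
      (Multiset.single_le_sum (fun x hx => ?_) _ (Multiset.mem_map_of_mem b hr))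
    obtain ⟨z, -, rfl⟩ := Multiset.mem_map.1 hx
    positivity
  have hder : ‖P.derivative.eval 0‖ = ‖P.eval 0‖ * s := by
    have h := hsplit.eval_derivative_div_eval_of_ne_zero h0
    have h' : (P.roots.map fun z => 1 / (0 - z)).sum = (s : ℂ) := by
      rw [hs, ← Complex.ofRealHom_eq_coe, map_multiset_sum, Multiset.map_map]
      refine congrArg Multiset.sum (Multiset.map_congr rfl fun r hr => ?_)
      rw [zero_sub, congrArg Neg.neg (hroots r hr).2]
      simp [b]
    rw [h', div_eq_iff h0] at h
    rw [h, norm_mul, Complex.norm_real, Real.norm_of_nonneg hspos.le, mul_comm]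
  have hev : ∀ t : ℝ, 0 < t →
      ‖P.eval (t : ℂ)‖ = ‖P.eval 0‖ * (P.roots.map fun r => 1 + b r * t).prod := by
    intro t ht
    rw [hsplit.eval_eq_prod_roots, hsplit.eval_eq_prod_roots, norm_mul, norm_mul, mul_assoc]
    congr 1
    have hnorm : ∀ m : Multiset ℂ, ‖m.prod‖ = (m.map norm).prod :=
      fun m => map_multiset_prod (normHom : ℂ →*₀ ℝ) m
    rw [hnorm, hnorm, Multiset.map_map, Multiset.map_map, ← Multiset.prod_map_mul]
    refine congrArg Multiset.prod (Multiset.map_congr rfl fun r hr => ?_)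
    have hr0 : 0 < ‖r‖ := norm_pos_iff.2 (hroots r hr).1
    have h' : (t : ℂ) - r = ((t + ‖r‖ : ℝ) : ℂ) := by
      rw [congrArg (fun z => (t : ℂ) - z) (hroots r hr).2]
      push_cast
      ring
    simp only [Function.comp_apply, h', Complex.norm_real, zero_sub, norm_neg, b,
      Real.norm_of_nonneg (add_pos ht hr0).le]
    field_simp
    ring
  have hk1 : (0 : ℝ) < k - 1 := by
    have : (2 : ℝ) ≤ k := by exact_mod_cast hk
    linarith
  have hkp : (0 : ℝ) < k := by linarith
  have ht : 0 < k / (s * (k - 1)) := by positivity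
  have h1 := hB _ ht
  rw [hev _ ht] at h1
  have h2 := Multiset.prod_map_le_pow_mul_exp P.roots (fun r => 1 + b r * (k / (s * (k - 1))))
    (fun i _ => by positivity) (m := k / (k - 1)) (by positivity)
  have hsum : (P.roots.map fun r => 1 + b r * (k / (s * (k - 1)))).sum = k + k / (k-1) := by
    rw [Multiset.sum_map_add, Multiset.sum_map_mul_right, ← hs]
    simp only [Multiset.map_const', Multiset.sum_replicate, hcard, nsmul_eq_mul, mul_one]
    field_simp
  rw [hsum, hcard] at h2
  have hz : ((k : ℝ) + k / (k-1)) / (k / (k - 1)) - k = 0 := by field_simp; ring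
  rw [hz, Real.exp_zero, mul_one] at h2
  have h3 := h1.trans (mul_le_mul_of_nonneg_left h2 (norm_nonneg _))
  rw [hder]
  have hpow : (k / (k - 1) : ℝ) ^ k = (k / (k - 1) : ℝ) ^ (k - 1) * (k / (k - 1)) := by
    rw [← pow_succ, Nat.sub_add_cancel (by omega)]
  have hinv : (k / (k - 1) : ℝ) ^ (k - 1) * (((k : ℝ) - 1) / k) ^ (k - 1) = 1 := by
    rw [← mul_pow, div_mul_div_cancel₀ hk1.ne', div_self hkp.ne', one_pow]
  rw [hpow] at h3
  calc B * (((k : ℝ) - 1) / k) ^ (k - 1)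
      = B * (k / (s * (k - 1))) * (s * (k - 1) / k * (((k : ℝ) - 1) / k) ^ (k - 1)) := by
        field_simp
    _ ≤ ‖P.eval 0‖ * ((k / (k - 1) : ℝ) ^ (k - 1) * (k / (k - 1))) *
        (s * (k - 1) / k * (((k : ℝ) - 1) / k) ^ (k - 1)) :=
        mul_le_mul_of_nonneg_right h3 (by positivity)
    _ = ‖P.eval 0‖ * s * ((k / (k - 1) : ℝ) ^ (k - 1) * (((k : ℝ) - 1) / k) ^ (k - 1)) *
        (k / (k - 1) * ((k - 1) / k)) := by ring
    _ = ‖P.eval 0‖ * s := by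
        rw [hinv, div_mul_div_cancel₀ hk1.ne', div_self hkp.ne', mul_one, mul_one]

/-- The permanent of `A` with each of its first `k` columns replaced by `w`. -/
def partialPermanent {R : Type*} [CommSemiring R] {n : ℕ} (A : Matrix (Fin n) (Fin n) R) (k : ℕ)
    (w : Fin n → R) : R :=
  (Matrix.of fun i j : Fin n => if (j : ℕ) < k then w i else A i j).permanent

lemma Fin.card_univ_filter_val_lt {n k : ℕ} (hk : k ≤ n) : #{j : Fin n | (j : ℕ) < k} = k := by
  rw [Fin.card_filter_val_lt, min_eq_right hk]

section Semiring

variable {R : Type*} [CommSemiring R] {n : ℕ} (A : Matrix (Fin n) (Fin n) R) {k : ℕ}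

lemma partialPermanent_eq_sum (w : Fin n → R) :
    partialPermanent A k w = ∑ σ : Equiv.Perm (Fin n),
      (∏ j ∈ univ.filter fun j : Fin n => (j : ℕ) < k, w (σ j)) *
        ∏ j ∈ univ.filter fun j : Fin n => ¬ (j : ℕ) < k, A (σ j) j := by
  simp only [partialPermanent, Matrix.permanent, Matrix.of_apply, Finset.prod_ite]

lemma partialPermanent_self (w : Fin n → R) :
    partialPermanent A n w = n.factorial * ∏ i, w i := by
  simp [partialPermanent, Matrix.permanent, Equiv.prod_comp, Fintype.card_perm]

lemma partialPermanent_smul (hk : k ≤ n) (c : R) (w : Fin n → R) :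
    partialPermanent A k (c • w) = c ^ k * partialPermanent A k w := by
  simp only [partialPermanent_eq_sum, Pi.smul_apply, smul_eq_mul, Finset.prod_mul_distrib,
    Finset.prod_const, Fin.card_univ_filter_val_lt hk, Finset.mul_sum, mul_assoc]

lemma map_partialPermanent {S : Type*} [CommSemiring S] (f : R →+* S) (w : Fin n → R) :
    f (partialPermanent A k w) = partialPermanent (A.map f) k (f ∘ w) := by
  simp [partialPermanent_eq_sum]

/-- The partial permanent along the line `w + X • a`, as a univariate polynomial. -/
noncomputable def partialPermanentPencil (k : ℕ) (w a : Fin n → R) : R[X] :=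
  partialPermanent (A.map C) k fun i => C (w i) + X * C (a i)

lemma eval_partialPermanentPencil (w a : Fin n → R) (t : R) :
    (partialPermanentPencil A k w a).eval t = partialPermanent A k (w + t • a) := by
  rw [partialPermanentPencil, ← coe_evalRingHom, map_partialPermanent]
  congr 1
  · ext; simp
  · ext
    simp
    ring

lemma natDegree_linear_le (a b : R) : (C b + X * C a).natDegree ≤ 1 := by
  compute_degree

lemma natDegree_partialPermanentPencil_le (hk : k ≤ n) (w a : Fin n → R) :
    (partialPermanentPencil A k w a).natDegree ≤ k := by
  rw [partialPermanentPencil, partialPermanent_eq_sum]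
  refine natDegree_sum_le_of_forall_le _ _ fun σ _ => natDegree_mul_le_of_le (m := k) (n := 0) ?_ ?_
  · refine (natDegree_prod_le _ _).trans ((Finset.sum_le_sum fun j _ =>
      natDegree_linear_le _ _).trans ?_)
    simp [Fin.card_univ_filter_val_lt hk]
  · refine (natDegree_prod_le _ _).trans ?_
    simp

lemma coeff_partialPermanentPencil (hk : k ≤ n) (w a : Fin n → R) :
    (partialPermanentPencil A k w a).coeff k = partialPermanent A k a := by
  simp only [partialPermanentPencil, partialPermanent_eq_sum, finsetSum_coeff, Matrix.map_apply]
  refine Finset.sum_congr rfl fun σ _ => ?_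
  rw [← map_prod, coeff_mul_C]
  congr 1
  have h := coeff_prod_of_natDegree_le {j : Fin n | (j : ℕ) < k}
    (fun j => C (w (σ j)) + X * C (a (σ j))) 1 fun j _ => natDegree_linear_le _ _
  rw [Fin.card_univ_filter_val_lt hk, mul_one] at h
  rw [h]
  simp [coeff_C]

lemma permanent_updateCol_eq_partialPermanent (w : Fin n → R) (hk : k < n) (j : Fin n)
    (hj : (j : ℕ) < k + 1) :
    ((Matrix.of fun i j : Fin n => if (j : ℕ) < k + 1 then w i else A i j).updateCol j
      fun i => A i ⟨k, hk⟩).permanent = partialPermanent A k w := by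
  refine Eq.trans ?_ (Matrix.permanent_permute_rows (Equiv.swap j ⟨k, hk⟩) _)
  congr 1
  ext i l
  simp only [Matrix.submatrix_apply, Matrix.of_apply, id, Matrix.updateCol_apply]
  rw [Equiv.swap_apply_def]
  by_cases h1 : l = j
  · simp [h1]
  · by_cases h2 : l = ⟨k, hk⟩
    · subst h2
      have : (j : ℕ) < k := by
        have : (j : ℕ) ≠ k := fun h => h1 (Fin.ext h.symm)
        omega
      simp [h1, this]
    · have : (l : ℕ) ≠ k := fun h => h2 (Fin.ext h)
      have : (l : ℕ) < k + 1 ↔ (l : ℕ) < k := by omega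
      simp [h1, h2, this]

lemma eval_zero_derivative_partialPermanentPencil (w : Fin n → R) (hk : k < n) :
    (derivative (partialPermanentPencil A (k + 1) w fun i => A i ⟨k, hk⟩)).eval 0 =
      (k + 1) * partialPermanent A k w := by
  have hterm : ∀ σ : Equiv.Perm (Fin n),
      (derivative (∏ j : Fin n, if (j : ℕ) < k + 1 then C (w (σ j)) + X * C (A (σ j) ⟨k, hk⟩)
        else C (A (σ j) j))).eval 0 =
      ∑ j ∈ univ.filter fun j : Fin n => (j : ℕ) < k + 1, ∏ l,
        ((Matrix.of fun i j : Fin n => if (j : ℕ) < k + 1 then w i else A i j).updateCol j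
          fun i => A i ⟨k, hk⟩) (σ l) l := by
    intro σ
    rw [derivative_prod_finset, eval_finsetSum, Finset.sum_filter]
    refine Finset.sum_congr rfl fun j _ => ?_
    split_ifs with hj
    · rw [← Finset.prod_erase_mul _ _ (mem_univ j), eval_mul, eval_prod]
      congr 1
      · refine Finset.prod_congr rfl fun l hl => ?_
        rw [Matrix.updateCol_ne (Finset.ne_of_mem_erase hl), Matrix.of_apply]
        split_ifs <;> simp
      · simp
    · simp
  rw [partialPermanentPencil, partialPermanent, Matrix.permanent, derivative_sum, eval_finsetSum]
  simp only [Matrix.of_apply, Matrix.map_apply, hterm]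
  rw [Finset.sum_comm]
  have := Finset.sum_congr rfl fun j (hj : j ∈ ({j : Fin n | (j : ℕ) < k + 1} : Finset (Fin n))) =>
    permanent_updateCol_eq_partialPermanent A w hk j (Finset.mem_filter.1 hj).2
  simp only [Matrix.permanent] at this
  rw [this, Finset.sum_const, Fin.card_univ_filter_val_lt hk, nsmul_eq_mul]
  push_cast
  rfl

end Semiring

section Positive

variable {n : ℕ} {A : Matrix (Fin n) (Fin n) ℝ}

lemma partialPermanent_pos (hA : ∀ i j, 0 < A i j) {k : ℕ} {w : Fin n → ℝ} (hw : ∀ i, 0 < w i) :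
    0 < partialPermanent A k w := by
  rw [partialPermanent_eq_sum]
  exact Finset.sum_pos (fun σ _ => mul_pos (Finset.prod_pos fun j _ => hw _)
    (Finset.prod_pos fun j _ => hA _ _)) Finset.univ_nonempty

lemma natDegree_partialPermanentPencil (hA : ∀ i j, 0 < A i j) {k : ℕ} (hk : k ≤ n)
    (w : Fin n → ℂ) {a : Fin n → ℝ} (ha : ∀ i, 0 < a i) :
    (partialPermanentPencil (A.map (algebraMap ℝ ℂ)) k w (algebraMap ℝ ℂ ∘ a)).natDegree = k := by
  refine natDegree_eq_of_le_of_coeff_ne_zero (natDegree_partialPermanentPencil_le _ hk _ _) ?_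
  rw [coeff_partialPermanentPencil _ hk, ← map_partialPermanent]
  exact (_root_.map_ne_zero _).2 (partialPermanent_pos hA ha).ne'

/-- Stability: for `A` positive, the partial permanent has no zero in the open right half-plane. -/
lemma partialPermanent_ne_zero_of_re_pos (hA : ∀ i j, 0 < A i j) {k : ℕ} (hk : k ≤ n) :
    ∀ w : Fin n → ℂ, (∀ i, 0 < (w i).re) →
      partialPermanent (A.map (algebraMap ℝ ℂ)) k w ≠ 0 := by
  induction hk using Nat.decreasingInduction with
  | self =>
    intro w hw
    rw [partialPermanent_self]
    refine mul_ne_zero (Nat.cast_ne_zero.2 n.factorial_ne_zero)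
      (Finset.prod_ne_zero_iff.2 fun i _ h => ?_)
    have := hw i
    simp [h] at this
  | of_succ k hk ih =>
    intro w hw h0
    set P := partialPermanentPencil (A.map (algebraMap ℝ ℂ)) (k + 1) w
      (algebraMap ℝ ℂ ∘ fun i => A i ⟨k, hk⟩) with hP
    have hdeg : P.natDegree = k + 1 :=
      natDegree_partialPermanentPencil hA hk w fun i => hA i ⟨k, hk⟩
    have hP0 : P ≠ 0 := by
      intro h
      simp [h] at hdeg
    have hsplit : P.Splits := IsAlgClosed.splits P
    have hroots : ∀ r ∈ P.roots, r.re < 0 := by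
      intro r hr
      by_contra! hre
      refine ih (w + r • (algebraMap ℝ ℂ ∘ fun i => A i ⟨k, hk⟩)) (fun i => ?_) ?_
      · have := mul_nonneg hre (hA i ⟨k, hk⟩).le
        have := hw i
        simp
        linarith
      · rw [← eval_partialPermanentPencil]
        exact (mem_roots hP0).1 hr
    have hev : P.eval 0 ≠ 0 := by
      rw [hP, eval_partialPermanentPencil, zero_smul, add_zero]
      exact ih w hw
    have hder : P.derivative.eval 0 = 0 := by
      refine (eval_zero_derivative_partialPermanentPencil (A.map (algebraMap ℝ ℂ)) w hk).trans ?_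
      rw [h0, mul_zero]
    have hsum := hsplit.eval_derivative_div_eval_of_ne_zero hev
    rw [hder, zero_div] at hsum
    have hpos : 0 < (P.roots.map fun z => (1 / (0 - z)).re).sum := by
      have hre : ∀ r ∈ P.roots, 0 < (1 / (0 - r)).re := by
        intro r hr
        have h1 := hroots r hr
        have h2 : 0 < Complex.normSq r := Complex.normSq_pos.2 (by rintro rfl; simp at h1)
        simp only [zero_sub, one_div, Complex.inv_re, Complex.neg_re, Complex.normSq_neg]
        exact div_pos (neg_pos.2 h1) h2
      obtain ⟨r, hr⟩ := Multiset.card_pos_iff_exists_mem.1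
        (show 0 < P.roots.card by rw [← hsplit.natDegree_eq_card_roots, hdeg]; omega)
      refine (hre r hr).trans_le (Multiset.single_le_sum (fun x hx => ?_) _
        (Multiset.mem_map_of_mem _ hr))
      obtain ⟨z, hz, rfl⟩ := Multiset.mem_map.1 hx
      exact (hre z hz).le
    have := congrArg Complex.reAddGroupHom hsum
    rw [map_multiset_sum, Multiset.map_map] at this
    exact hpos.ne this

lemma Fin.filter_val_lt_succ {k : ℕ} (hk : k < n) :
    (univ.filter fun j : Fin n => (j : ℕ) < k + 1) =
      insert ⟨k, hk⟩ (univ.filter fun j : Fin n => (j : ℕ) < k) := by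
  ext j
  simp [Fin.ext_iff]
  omega

/-- Gurvits's capacity inequality for the partial permanents of a positive matrix. -/
lemma le_norm_partialPermanent (hA : ∀ i j, 0 < A i j)
    (hcap : ∀ x : Fin n → ℝ, (∀ j, 0 < x j) → ∏ j, x j ≤ ∏ i, ∑ j, A i j * x j)
    {k : ℕ} (hk : k ≤ n) : 1 ≤ k → ∀ x : Fin n → ℝ, (∀ j, 0 < x j) →
      (n.factorial / n ^ n : ℝ) * k ^ k * ∏ j ∈ univ.filter fun j : Fin n => (j : ℕ) < k, x j ≤
        ‖partialPermanent (A.map (algebraMap ℝ ℂ)) k (algebraMap ℝ ℂ ∘ fun i =>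
          ∑ j ∈ univ.filter fun j : Fin n => (j : ℕ) < k, A i j * x j)‖ := by
  induction hk using Nat.decreasingInduction with
  | self =>
    intro hn x hx
    have hn0 : (n : ℝ) ≠ 0 := by positivity
    rw [← map_partialPermanent, partialPermanent_self, norm_algebraMap', norm_mul,
      Real.norm_of_nonneg (Nat.cast_nonneg _), div_mul_cancel₀ _ (pow_ne_zero _ hn0)]
    simp only [Fin.is_lt, Finset.filter_true]
    gcongr
    exact (hcap x hx).trans (Real.le_norm_self _)
  | of_succ k hk ih =>
    intro hk1 x hx
    set y : Fin n → ℝ := fun i => ∑ j ∈ univ.filter fun j : Fin n => (j : ℕ) < k, A i j * x j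
      with hy
    have hypos : ∀ i, 0 < y i := fun i => Finset.sum_pos (fun j _ => mul_pos (hA i j) (hx j))
      ⟨⟨0, by omega⟩, by simp; omega⟩
    set a : Fin n → ℝ := fun i => A i ⟨k, hk⟩ with ha
    set P := partialPermanentPencil (A.map (algebraMap ℝ ℂ)) (k + 1) (algebraMap ℝ ℂ ∘ y)
      (algebraMap ℝ ℂ ∘ a) with hP
    have hdeg : P.natDegree = k + 1 :=
      natDegree_partialPermanentPencil hA hk _ fun i => hA i ⟨k, hk⟩
    have hP0 : P ≠ 0 := by
      intro h
      simp [h] at hdeg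
    have hst := partialPermanent_ne_zero_of_re_pos hA (Nat.succ_le_of_lt hk)
    have hroots : ∀ r ∈ P.roots, r ≠ 0 ∧ r = -(‖r‖ : ℂ) := by
      intro r hr
      have hr' : P.eval r = 0 := (mem_roots hP0).1 hr
      rw [hP, eval_partialPermanentPencil] at hr'
      refine ⟨?_, ?_⟩
      · rintro rfl
        rw [zero_smul, add_zero] at hr'
        exact hst _ (fun i => by simpa using hypos i) hr'
      · by_contra hne
        obtain ⟨l, hl, hlr⟩ := Complex.exists_re_pos_re_mul_pos hne
        refine hst (l • (algebraMap ℝ ℂ ∘ y + r • (algebraMap ℝ ℂ ∘ a))) (fun i => ?_) ?_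
        · have h : (l • (algebraMap ℝ ℂ ∘ y + r • (algebraMap ℝ ℂ ∘ a))) i =
              l * (y i : ℂ) + l * r * (a i : ℂ) := by
            simp
            ring
          rw [h, Complex.add_re, Complex.re_mul_ofReal, Complex.re_mul_ofReal]
          exact add_pos (mul_pos hl (hypos i)) (mul_pos hlr (hA i _))
        · rw [partialPermanent_smul _ (Nat.succ_le_of_lt hk), hr', mul_zero]
    have hnot : (⟨k, hk⟩ : Fin n) ∉ univ.filter fun j : Fin n => (j : ℕ) < k := by simp
    set B : ℝ := (n.factorial / n ^ n : ℝ) * ((k + 1 : ℕ) : ℝ) ^ (k + 1) *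
      ∏ j ∈ univ.filter fun j : Fin n => (j : ℕ) < k, x j with hBdef
    have hB : ∀ t : ℝ, 0 < t → B * t ≤ ‖P.eval (t : ℂ)‖ := by
      intro t ht
      have h := ih (by omega) (Function.update x ⟨k, hk⟩ t) fun j => by
        rcases eq_or_ne j ⟨k, hk⟩ with rfl | hj
        · simpa using ht
        · simpa [hj] using hx j
      have hupd : ∀ j ∈ univ.filter fun j : Fin n => (j : ℕ) < k,
          Function.update x ⟨k, hk⟩ t j = x j := fun j hj =>
        Function.update_of_ne (ne_of_mem_of_not_mem hj hnot) _ _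
      rw [Fin.filter_val_lt_succ hk, Finset.prod_insert hnot, Finset.prod_congr rfl hupd] at h
      rw [hP, eval_partialPermanentPencil]
      convert h using 1
      · simp [hBdef]
        ring
      · congr 2
        ext i
        simp only [Pi.add_apply, Pi.smul_apply, Function.comp_apply, smul_eq_mul,
          Finset.sum_insert hnot, Function.update_self]
        rw [Finset.sum_congr rfl fun j hj => by rw [hupd j hj]]
        simp [hy, ha]
        ring
    have h := Polynomial.le_norm_eval_derivative_zero (by omega) hdeg hroots hB
    have hder : P.derivative.eval 0 = (k + 1) * partialPermanent (A.map (algebraMap ℝ ℂ)) k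
        (algebraMap ℝ ℂ ∘ y) :=
      eval_zero_derivative_partialPermanentPencil (A.map (algebraMap ℝ ℂ)) _ hk
    have hnorm : ‖(k : ℂ) + 1‖ = (k : ℝ) + 1 := by
      rw [← Nat.cast_succ, Complex.norm_natCast, Nat.cast_succ]
    rw [hder, norm_mul, hnorm] at h
    have hkp : (0 : ℝ) < k + 1 := by positivity
    refine le_of_mul_le_mul_left (le_of_eq_of_le ?_ h) hkp
    rw [hBdef]
    simp only [Nat.add_sub_cancel, Nat.cast_add, Nat.cast_one, add_sub_cancel_right, div_pow]
    field_simp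
    ring

lemma partialPermanent_one_col {R : Type*} [CommSemiring R] (M : Matrix (Fin n) (Fin n) R)
    (hn : 0 < n) : partialPermanent M 1 (fun i => M i ⟨0, hn⟩) = M.permanent := by
  rw [partialPermanent]
  congr 1
  ext i j
  simp only [Matrix.of_apply]
  split_ifs with h
  · rw [show j = ⟨0, hn⟩ from Fin.ext (by simpa using h)]
  · rfl

lemma factorial_div_pow_le_permanent_of_pos (hA : ∀ i j, 0 < A i j)
    (hA' : A ∈ doublyStochastic ℝ (Fin n)) : (n.factorial / n ^ n : ℝ) ≤ A.permanent := by
  rcases Nat.eq_zero_or_pos n with rfl | hn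
  · simp [Matrix.permanent]
  have hcap : ∀ x : Fin n → ℝ, (∀ j, 0 < x j) → ∏ j, x j ≤ ∏ i, ∑ j, A i j * x j := by
    intro x hx
    calc ∏ j, x j = ∏ j, x j ^ (∑ i, A i j) := by
          simp [sum_col_of_mem_doublyStochastic hA']
      _ = ∏ j, ∏ i, x j ^ A i j :=
          Finset.prod_congr rfl fun j _ => Real.rpow_sum_of_pos (hx j) _ _
      _ = ∏ i, ∏ j, x j ^ A i j := Finset.prod_comm
      _ ≤ ∏ i, ∑ j, A i j * x j := by
          refine Finset.prod_le_prod (fun i _ => Finset.prod_nonneg fun j _ =>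
            Real.rpow_nonneg (hx j).le _) fun i _ => ?_
          exact Real.geom_mean_le_arith_mean_weighted _ _ _ (fun j _ => (hA i j).le)
            (sum_row_of_mem_doublyStochastic hA' i) fun j _ => (hx j).le
  have h := le_norm_partialPermanent hA hcap (show 1 ≤ n from hn) le_rfl 1 fun _ => one_pos
  have hfil : (univ.filter fun j : Fin n => (j : ℕ) < 1) = {⟨0, hn⟩} := by
    ext j
    simp [Fin.ext_iff]
  rw [hfil, ← map_partialPermanent, norm_algebraMap'] at h
  simp only [Finset.sum_singleton, Finset.prod_singleton, Pi.one_apply, mul_one, Nat.cast_one,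
    one_pow, partialPermanent_one_col] at h
  rwa [Real.norm_of_nonneg] at h
  exact Finset.sum_nonneg fun σ _ => Finset.prod_nonneg fun j _ => (hA _ _).le

/-- The van der Waerden bound (Falikman, Egorychev) for doubly stochastic matrices. -/
theorem factorial_div_pow_le_permanent (hA : A ∈ doublyStochastic ℝ (Fin n)) :
    (n.factorial / n ^ n : ℝ) ≤ A.permanent := by
  rcases Nat.eq_zero_or_pos n with rfl | hn
  · simp [Matrix.permanent]
  have hn' : (0 : ℝ) < n := by exact_mod_cast hn
  let J : Matrix (Fin n) (Fin n) ℝ := Matrix.of fun _ _ => (n : ℝ)⁻¹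
  have hJ : J ∈ doublyStochastic ℝ (Fin n) := by
    rw [mem_doublyStochastic_iff_sum]
    refine ⟨fun i j => by simp [J], fun i => ?_, fun j => ?_⟩ <;> simp [J, hn'.ne']
  let F : ℝ → Matrix (Fin n) (Fin n) ℝ := fun ε => (1 - ε) • A + ε • J
  have hcont : Continuous fun ε => (F ε).permanent := by
    simp only [F, Matrix.permanent, Matrix.add_apply, Matrix.smul_apply]
    fun_prop
  have hlim := (hcont.tendsto 0).mono_left (nhdsWithin_le_nhds (s := Set.Ioi 0))
  have hF0 : F 0 = A := by simp [F]
  rw [hF0] at hlim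
  refine ge_of_tendsto hlim ?_
  filter_upwards [Ioo_mem_nhdsGT (zero_lt_one' ℝ)] with ε hε
  refine factorial_div_pow_le_permanent_of_pos (fun i j => ?_) ?_
  · have h1 : 0 ≤ (1 - ε) * A i j :=
      mul_nonneg (by linarith [hε.2]) (nonneg_of_mem_doublyStochastic hA)
    have h2 : 0 < ε * (n : ℝ)⁻¹ := mul_pos hε.1 (inv_pos.2 hn')
    simp only [F, J, Matrix.add_apply, Matrix.smul_apply, Matrix.of_apply, smul_eq_mul]
    linarith
  · exact convex_doublyStochastic hA hJ (by linarith [hε.2]) hε.1.le (by ring)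

end Positive

section Factors

variable {n : ℕ}

/-- The spanning `d`-regular subgraphs (`d`-factors) of the bipartite graph `E`. -/
def regularFactors (E : Finset (Fin n × Fin n)) (d : ℕ) : Finset (Finset (Fin n × Fin n)) :=
  {F ∈ E.powerset | (∀ i, rowDeg F i = d) ∧ ∀ v, colDeg F v = d}

lemma mem_regularFactors {E F : Finset (Fin n × Fin n)} {d : ℕ} :
    F ∈ regularFactors E d ↔ F ⊆ E ∧ (∀ i, rowDeg F i = d) ∧ ∀ v, colDeg F v = d := by
  simp [regularFactors]

lemma ncard_eq_card_regularFactors (E : Finset (Fin n × Fin n)) (d : ℕ) :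
    Set.ncard {F : Finset (Fin n × Fin n) |
      F ⊆ E ∧ (∀ i, rowDeg F i = d) ∧ (∀ v, colDeg F v = d)} = #(regularFactors E d) := by
  rw [← Set.ncard_coe_finset]
  congr 1
  ext F
  simp [mem_regularFactors]

lemma rowDeg_union {M N : Finset (Fin n × Fin n)} (h : Disjoint M N) (i : Fin n) :
    rowDeg (M ∪ N) i = rowDeg M i + rowDeg N i := by
  rw [rowDeg, Finset.filter_union, Finset.card_union_of_disjoint (Finset.disjoint_filter_filter h)]
  rfl

lemma colDeg_union {M N : Finset (Fin n × Fin n)} (h : Disjoint M N) (v : Fin n) :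
    colDeg (M ∪ N) v = colDeg M v + colDeg N v := by
  rw [colDeg, Finset.filter_union, Finset.card_union_of_disjoint (Finset.disjoint_filter_filter h)]
  rfl

lemma rowDeg_sdiff {M E : Finset (Fin n × Fin n)} (h : M ⊆ E) (i : Fin n) :
    rowDeg (E \ M) i = rowDeg E i - rowDeg M i := by
  have := rowDeg_union (Finset.sdiff_disjoint (s := M) (t := E)) i
  rw [Finset.sdiff_union_of_subset h] at this
  omega

lemma colDeg_sdiff {M E : Finset (Fin n × Fin n)} (h : M ⊆ E) (v : Fin n) :
    colDeg (E \ M) v = colDeg E v - colDeg M v := by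
  have := colDeg_union (Finset.sdiff_disjoint (s := M) (t := E)) v
  rw [Finset.sdiff_union_of_subset h] at this
  omega

lemma rowDeg_eq_card (E : Finset (Fin n × Fin n)) (i : Fin n) :
    rowDeg E i = #{j | (i, j) ∈ E} := by
  refine (Finset.card_nbij' (fun j => (i, j)) Prod.snd ?_ ?_ ?_ ?_).symm <;>
    simp +contextual [Set.MapsTo, Set.LeftInvOn]
  all_goals grind

lemma colDeg_eq_card (E : Finset (Fin n × Fin n)) (v : Fin n) :
    colDeg E v = #{i | (i, v) ∈ E} := by
  refine (Finset.card_nbij' (fun i => (i, v)) Prod.fst ?_ ?_ ?_ ?_).symm <;>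
    simp +contextual [Set.MapsTo, Set.LeftInvOn]
  all_goals grind

/-- A subgraph with exactly one edge in each row is given by a choice of an edge in each row. -/
lemma card_subsets_rowDeg_one_le (F : Finset (Fin n × Fin n)) :
    #{M ∈ F.powerset | ∀ i, rowDeg M i = 1} ≤ ∏ i, rowDeg F i := by
  have hsub : {M ∈ F.powerset | ∀ i, rowDeg M i = 1} ⊆
      (Fintype.piFinset fun i => F.filter fun p => p.1 = i).image fun f => univ.image f := by
    intro M hM
    obtain ⟨hMF, hM1⟩ := Finset.mem_filter.1 hM
    rw [Finset.mem_powerset] at hMF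
    choose f hf using fun i => Finset.card_eq_one.1 (hM1 i)
    have hmem : ∀ i, f i ∈ M ∧ (f i).1 = i := fun i =>
      Finset.mem_filter.1 (hf i ▸ Finset.mem_singleton_self (f i))
    refine Finset.mem_image.2 ⟨f, Fintype.mem_piFinset.2 fun i =>
      Finset.mem_filter.2 ⟨hMF (hmem i).1, (hmem i).2⟩, ?_⟩
    ext p
    simp only [Finset.mem_image, Finset.mem_univ, true_and]
    refine ⟨fun ⟨i, hi⟩ => hi ▸ (hmem i).1, fun hp => ⟨p.1, ?_⟩⟩
    have : p ∈ M.filter fun q => q.1 = p.1 := Finset.mem_filter.2 ⟨hp, rfl⟩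
    rw [hf p.1, Finset.mem_singleton] at this
    exact this.symm
  calc _ ≤ _ := Finset.card_le_card hsub
    _ ≤ _ := Finset.card_image_le
    _ = ∏ i, rowDeg F i := by rw [Fintype.card_piFinset]; rfl

/-- Each 2-factor is the union of at most `2 ^ n` ordered pairs of disjoint perfect matchings. -/
lemma sum_card_regularFactors_sdiff_le (E : Finset (Fin n × Fin n)) :
    ∑ M ∈ regularFactors E 1, #(regularFactors (E \ M) 1) ≤ #(regularFactors E 2) * 2 ^ n := by
  rw [← Finset.card_sigma, mul_comm]
  refine Finset.card_le_mul_card_image_of_maps_to (f := fun p => p.1 ∪ p.2) ?_ _ ?_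
  · rintro ⟨M, N⟩ h
    simp only [Finset.mem_sigma, mem_regularFactors] at h ⊢
    obtain ⟨⟨hM, hMr, hMc⟩, hN, hNr, hNc⟩ := h
    have hd : Disjoint M N := Finset.disjoint_sdiff.mono_right hN
    refine ⟨Finset.union_subset hM (hN.trans Finset.sdiff_subset), fun i => ?_, fun v => ?_⟩
    · rw [rowDeg_union hd, hMr, hNr]
    · rw [colDeg_union hd, hMc, hNc]
  · intro F hF
    obtain ⟨-, hFr, -⟩ := mem_regularFactors.1 hF
    have hle := card_subsets_rowDeg_one_le F
    simp only [hFr, Finset.prod_const, Finset.card_univ, Fintype.card_fin] at hle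
    refine le_trans (Finset.card_le_card_of_injOn Sigma.fst ?_ ?_) hle
    · rintro ⟨M, N⟩ h
      simp only [Finset.coe_filter, Set.mem_ofPred_eq, Finset.mem_sigma, mem_regularFactors] at h
      obtain ⟨⟨⟨-, hMr, -⟩, -⟩, rfl⟩ := h
      exact Finset.mem_coe.2 (Finset.mem_filter.2
        ⟨Finset.mem_powerset.2 Finset.subset_union_left, hMr⟩)
    · rintro ⟨M, N⟩ h ⟨M', N'⟩ h' (rfl : M = M')
      simp only [Finset.coe_filter, Set.mem_ofPred_eq, Finset.mem_sigma, mem_regularFactors] at h h'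
      have hd : Disjoint M N := Finset.disjoint_sdiff.mono_right h.1.2.1
      have hd' : Disjoint M N' := Finset.disjoint_sdiff.mono_right h'.1.2.1
      have hNN : N = N' := by
        rw [← Finset.union_sdiff_cancel_left hd, ← Finset.union_sdiff_cancel_left hd',
          h.2, h'.2]
      rw [hNN]

lemma sdiff_regular {E M : Finset (Fin n × Fin n)} {k : ℕ} (hr : ∀ i, rowDeg E i = k)
    (hc : ∀ v, colDeg E v = k) (hM : M ∈ regularFactors E 1) :
    (∀ i, rowDeg (E \ M) i = k - 1) ∧ ∀ v, colDeg (E \ M) v = k - 1 := by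
  obtain ⟨hME, hMr, hMc⟩ := mem_regularFactors.1 hM
  exact ⟨fun i => by rw [rowDeg_sdiff hME, hr, hMr], fun v => by rw [colDeg_sdiff hME, hc, hMc]⟩

lemma pmMin_le_card_regularFactors {E : Finset (Fin n × Fin n)} {k : ℕ}
    (hr : ∀ i, rowDeg E i = k) (hc : ∀ v, colDeg E v = k) :
    pmMin n k ≤ #(regularFactors E 1) :=
  Nat.sInf_le ⟨E, hr, hc, (ncard_eq_card_regularFactors E 1).symm⟩

/-- The van der Waerden bound for perfect matchings of a `k`-regular bipartite graph. -/
lemma factorial_mul_pow_le_card_regularFactors {E : Finset (Fin n × Fin n)} {k : ℕ} (hk : 0 < k)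
    (hr : ∀ i, rowDeg E i = k) (hc : ∀ v, colDeg E v = k) :
    (n.factorial * (k / n) ^ n : ℝ) ≤ #(regularFactors E 1) := by
  have hk' : (0 : ℝ) < k := by exact_mod_cast hk
  let B : Matrix (Fin n) (Fin n) ℝ := Matrix.of fun i j => if (i, j) ∈ E then 1 else 0
  have hB : (k : ℝ)⁻¹ • B ∈ doublyStochastic ℝ (Fin n) := by
    rw [mem_doublyStochastic_iff_sum]
    refine ⟨fun i j => ?_, fun i => ?_, fun j => ?_⟩
    · simp only [B, Matrix.smul_apply, Matrix.of_apply, smul_eq_mul]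
      positivity
    · simp only [B, Matrix.smul_apply, Matrix.of_apply, smul_eq_mul, ← Finset.mul_sum,
        Finset.sum_boole, ← rowDeg_eq_card, hr, inv_mul_cancel₀ hk'.ne']
    · simp only [B, Matrix.smul_apply, Matrix.of_apply, smul_eq_mul, ← Finset.mul_sum,
        Finset.sum_boole, ← colDeg_eq_card, hc, inv_mul_cancel₀ hk'.ne']
  have h := factorial_div_pow_le_permanent hB
  rw [Matrix.permanent_smul, Fintype.card_fin, inv_pow, inv_mul_eq_div,
    le_div_iff₀ (pow_pos hk' n)] at h
  have hper : B.permanent = #{σ : Equiv.Perm (Fin n) | ∀ j, (σ j, j) ∈ E} := by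
    simp [Matrix.permanent, B, Finset.prod_ite_zero]
  have hcard : #{σ : Equiv.Perm (Fin n) | ∀ j, (σ j, j) ∈ E} ≤ #(regularFactors E 1) := by
    refine Finset.card_le_card_of_injOn (fun σ => univ.image fun j => (σ j, j)) ?_ ?_
    · intro σ hσ
      simp only [Finset.coe_filter, Finset.mem_univ, true_and, Set.mem_ofPred_eq] at hσ
      refine mem_regularFactors.2 ⟨?_, fun i => ?_, fun v => ?_⟩
      · intro p hp
        obtain ⟨j, -, rfl⟩ := Finset.mem_image.1 hp
        exact hσ j
      · rw [rowDeg_eq_card, Finset.card_eq_one]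
        refine ⟨σ.symm i, ?_⟩
        ext j
        simp [Equiv.eq_symm_apply, eq_comm]
      · rw [colDeg_eq_card, Finset.card_eq_one]
        refine ⟨σ v, ?_⟩
        ext j
        simp [eq_comm]
    · intro σ _ τ _ hστ
      ext j
      have : (σ j, j) ∈ univ.image fun j => (τ j, j) :=
        (Finset.ext_iff.1 hστ _).1 (Finset.mem_image_of_mem (fun j => (σ j, j)) (Finset.mem_univ j))
      simp at this
      rw [this]
  calc (n.factorial * (k / n) ^ n : ℝ) = n.factorial / n ^ n * k ^ n := by
        rw [div_pow]
        ring
    _ ≤ B.permanent := h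
    _ ≤ #(regularFactors E 1) := by rw [hper]; exact_mod_cast hcard

end Factors

/-- A `k`-regular bipartite graph `H` (`k ≥ 2` even, sides of size `n`) has at least
`P(k)·P(k−1)/2^n` 2-factors, and in particular at least `n!²·(k(k−1))^n/(n^(2n)·2^n)`
2-factors. -/
theorem stmt19 {n k : ℕ} (hk2 : 2 ≤ k) (hkeven : Even k)
    (H : Finset (Fin n × Fin n))
    (hr : ∀ i, rowDeg H i = k) (hc : ∀ v, colDeg H v = k) :
    pmMin n k * pmMin n (k - 1) ≤
      Set.ncard {F : Finset (Fin n × Fin n) |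
        F ⊆ H ∧ (∀ i, rowDeg F i = 2) ∧ (∀ v, colDeg F v = 2)} * 2 ^ n ∧
    ((Nat.factorial n : ℝ)) ^ 2 * ((k : ℝ) * (k - 1)) ^ n / ((n : ℝ) ^ (2 * n) * 2 ^ n) ≤
      (Set.ncard {F : Finset (Fin n × Fin n) |
        F ⊆ H ∧ (∀ i, rowDeg F i = 2) ∧ (∀ v, colDeg F v = 2)} : ℝ) := by
  rw [ncard_eq_card_regularFactors]
  have hsum := sum_card_regularFactors_sdiff_le H
  constructor
  · calc pmMin n k * pmMin n (k - 1)
        ≤ #(regularFactors H 1) * pmMin n (k - 1) :=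
          Nat.mul_le_mul_right _ (pmMin_le_card_regularFactors hr hc)
      _ = ∑ _M ∈ regularFactors H 1, pmMin n (k - 1) := by simp
      _ ≤ ∑ M ∈ regularFactors H 1, #(regularFactors (H \ M) 1) :=
          Finset.sum_le_sum fun M hM => pmMin_le_card_regularFactors
            (sdiff_regular hr hc hM).1 (sdiff_regular hr hc hM).2
      _ ≤ _ := hsum
  · have hk1 : ((k - 1 : ℕ) : ℝ) = (k : ℝ) - 1 := by
      rw [Nat.cast_sub (by omega), Nat.cast_one]
    have hk0 : (0 : ℝ) ≤ (k : ℝ) - 1 := by rw [← hk1]; positivity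
    rw [← div_div, div_le_iff₀ (by positivity)]
    calc (n.factorial : ℝ) ^ 2 * ((k : ℝ) * (k - 1)) ^ n / (n : ℝ) ^ (2 * n)
        = (n.factorial * (k / n) ^ n) * (n.factorial * (((k : ℝ) - 1) / n) ^ n) := by
          rw [div_pow, div_pow, mul_pow, two_mul, pow_add]
          ring
      _ ≤ #(regularFactors H 1) * (n.factorial * (((k : ℝ) - 1) / n) ^ n) := by
          gcongr
          exact factorial_mul_pow_le_card_regularFactors (by omega) hr hc
      _ = ∑ _M ∈ regularFactors H 1, (n.factorial * (((k : ℝ) - 1) / n) ^ n) := by simp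
      _ ≤ ∑ M ∈ regularFactors H 1, (#(regularFactors (H \ M) 1) : ℝ) := by
          refine Finset.sum_le_sum fun M hM => ?_
          rw [← hk1]
          exact factorial_mul_pow_le_card_regularFactors (by omega)
            (sdiff_regular hr hc hM).1 (sdiff_regular hr hc hM).2
      _ ≤ #(regularFactors H 2) * 2 ^ n := by exact_mod_cast hsum
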